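/- Let n ≥ 2 and write Δ^{(n-1)}(Ω) = Ω_{(1)} ⊗ Ω_{(2)} ⊗ ⋯ ⊗ Ω_{(n)}. For every subset I ⊆ {1, …, n}, applying J to the tensor legs indexed by I of Ω_{(1)} ⊗ Ω_{(2)} ⊗ ⋯ ⊗ Ω_{(n)} yields the same element of A^{⊗n} as applying J to the tensor legs indexed by the complement of I of the reordered coproduct Ω_{(1)} ⊗ Ω_{(n)} ⊗ Ω_{(n-1)} ⊗ ⋯ ⊗ Ω_{(2)}; that is, (F_1 ⊗ ⋯ ⊗ F_n)(Δ^{(n-1)}(Ω)) = (G_1 ⊗ ⋯ ⊗ G_n)(Ω_{(1)} ⊗ Ω_{(n)} ⊗ Ω_{(n-1)} ⊗ ⋯ ⊗ Ω_{(2)}), where F_i = J and G_i = id for i ∈ I, and F_i = id and G_i = J for i ∉ I. -/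

import Mathlib

open scoped TensorProduct

noncomputable section

/-- An element of a `C*`-algebra is positive iff it is of the form `star y * y`. -/
def IsPosElem {A : Type*} [Mul A] [Star A] (x : A) : Prop := ∃ y : A, x = star y * y

section Helpers

variable {A : Type*} [NormedRing A] [StarRing A] [CStarRing A]
  [NormedAlgebra ℂ A] [StarModule ℂ A]

/-- Apply a linear functional to the first leg of a tensor (`⟨φ, u₁⟩ u₂`). -/
def lapp (φ : A →ₗ[ℂ] ℂ) : A ⊗[ℂ] A →ₗ[ℂ] A :=
  (TensorProduct.lid ℂ A).toLinearMap ∘ₗ TensorProduct.map φ LinearMap.id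

/-- Apply a linear functional to the second leg of a tensor (`⟨φ, u₂⟩ u₁`). -/
def rapp (φ : A →ₗ[ℂ] ℂ) : A ⊗[ℂ] A →ₗ[ℂ] A :=
  (TensorProduct.rid ℂ A).toLinearMap ∘ₗ TensorProduct.map LinearMap.id φ

/-- Apply a pair of linear functionals to the two legs of a tensor (`⟨φ, u₁⟩⟨ψ, u₂⟩`). -/
def papp (φ ψ : A →ₗ[ℂ] ℂ) : A ⊗[ℂ] A →ₗ[ℂ] ℂ :=
  (TensorProduct.lid ℂ ℂ).toLinearMap ∘ₗ TensorProduct.map φ ψ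

end Helpers

/-- A `C*`-weak Hopf algebra: a finite-dimensional unital `C*`-algebra `A` equipped with a
comultiplication `Δ` (written in Sweedler notation `Δ x = x₍₁₎ ⊗ x₍₂₎`), counit `ε` and
antipode `S`, satisfying the axioms of Böhm–Szlachányi.  The field `starT` is the
(componentwise) star operation on `A ⊗[ℂ] A`, characterized by additivity and its values on
pure tensors. -/
structure WeakHopfData (A : Type*) [NormedRing A] [StarRing A] [CStarRing A]
    [NormedAlgebra ℂ A] [StarModule ℂ A] [FiniteDimensional ℂ A] : Type _ where
  Δ : A →ₗ[ℂ] A ⊗[ℂ] A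
  ε : A →ₗ[ℂ] ℂ
  S : A ≃ₗ[ℂ] A
  starT : A ⊗[ℂ] A → A ⊗[ℂ] A
  starT_add : ∀ u v : A ⊗[ℂ] A, starT (u + v) = starT u + starT v
  starT_tmul : ∀ a b : A, starT (a ⊗ₜ[ℂ] b) = star a ⊗ₜ[ℂ] star b
  /-- coassociativity of the comultiplication -/
  coassoc : (TensorProduct.assoc ℂ A A A).toLinearMap ∘ₗ
      (TensorProduct.map Δ LinearMap.id) ∘ₗ Δ = (TensorProduct.map LinearMap.id Δ) ∘ₗ Δ
  /-- counit axiom, left version -/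
  counit_left : (TensorProduct.lid ℂ A).toLinearMap ∘ₗ (TensorProduct.map ε LinearMap.id) ∘ₗ Δ
      = LinearMap.id
  /-- counit axiom, right version -/
  counit_right : (TensorProduct.rid ℂ A).toLinearMap ∘ₗ (TensorProduct.map LinearMap.id ε) ∘ₗ Δ
      = LinearMap.id
  /-- the comultiplication is multiplicative -/
  Δ_mul : ∀ x y : A, Δ (x * y) = Δ x * Δ y
  /-- the star operation is comultiplicative -/
  Δ_star : ∀ x : A, Δ (star x) = starT (Δ x)
  /-- the unit is weakly comultiplicative:
  `(Δ ⊗ id)(Δ 1) = (Δ 1 ⊗ 1)(1 ⊗ Δ 1)` -/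
  Δ_one_weak : (TensorProduct.map Δ LinearMap.id) (Δ 1)
      = (Δ 1 ⊗ₜ[ℂ] (1 : A)) * ((TensorProduct.assoc ℂ A A A).symm ((1 : A) ⊗ₜ[ℂ] Δ 1))
  /-- the unit is weakly comultiplicative:
  `(Δ ⊗ id)(Δ 1) = (1 ⊗ Δ 1)(Δ 1 ⊗ 1)` -/
  Δ_one_weak' : (TensorProduct.map Δ LinearMap.id) (Δ 1)
      = ((TensorProduct.assoc ℂ A A A).symm ((1 : A) ⊗ₜ[ℂ] Δ 1)) * (Δ 1 ⊗ₜ[ℂ] (1 : A))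
  /-- the counit is weakly multiplicative: `ε (x y z) = ε (x y₍₁₎) ε (y₍₂₎ z)` -/
  ε_weak : ∀ x y z : A,
      ε (x * y * z) = papp (ε ∘ₗ LinearMap.mulLeft ℂ x) (ε ∘ₗ LinearMap.mulRight ℂ z) (Δ y)
  /-- the counit is weakly multiplicative: `ε (x y z) = ε (x y₍₂₎) ε (y₍₁₎ z)` -/
  ε_weak' : ∀ x y z : A,
      ε (x * y * z) = papp (ε ∘ₗ LinearMap.mulRight ℂ z) (ε ∘ₗ LinearMap.mulLeft ℂ x) (Δ y)
  /-- antipode axiom: `x₍₁₎ S(x₍₂₎) = ε (1₍₁₎ x) 1₍₂₎` -/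
  antipode_left : ∀ x : A,
      LinearMap.mul' ℂ A ((TensorProduct.map LinearMap.id S.toLinearMap) (Δ x))
        = lapp (ε ∘ₗ LinearMap.mulRight ℂ x) (Δ 1)
  /-- antipode axiom: `S(x₍₁₎) x₍₂₎ = 1₍₁₎ ε (x 1₍₂₎)` -/
  antipode_right : ∀ x : A,
      LinearMap.mul' ℂ A ((TensorProduct.map S.toLinearMap LinearMap.id) (Δ x))
        = rapp (ε ∘ₗ LinearMap.mulLeft ℂ x) (Δ 1)
  /-- the antipode is antimultiplicative -/
  S_antimul : ∀ x y : A, S (x * y) = S y * S x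
  /-- the antipode is anticomultiplicative -/
  S_anticomul : ∀ x : A,
      Δ (S x) = (TensorProduct.comm ℂ A A) ((TensorProduct.map S.toLinearMap S.toLinearMap) (Δ x))

namespace WeakHopfData

variable {A : Type*} [NormedRing A] [StarRing A] [CStarRing A]
  [NormedAlgebra ℂ A] [StarModule ℂ A] [FiniteDimensional ℂ A]

/-- The source counital map `ε^L (x) = x₍₁₎ S(x₍₂₎)`. -/
def εL (W : WeakHopfData A) : A →ₗ[ℂ] A :=
  LinearMap.mul' ℂ A ∘ₗ TensorProduct.map LinearMap.id W.S.toLinearMap ∘ₗ W.Δ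

/-- The target counital map `ε^R (x) = S(x₍₁₎) x₍₂₎`. -/
def εR (W : WeakHopfData A) : A →ₗ[ℂ] A :=
  LinearMap.mul' ℂ A ∘ₗ TensorProduct.map W.S.toLinearMap LinearMap.id ∘ₗ W.Δ

/-- Full contraction of the iterated coproduct `Δ⁽ⁿ⁾ x = x₍₁₎ ⊗ ⋯ ⊗ x₍ₙ₊₁₎` against a family
of `n+1` linear functionals: `sweedlerEval W n φ x = ⟨φ 0, x₍₁₎⟩ ⋯ ⟨φ n, x₍ₙ₊₁₎⟩`.
Since linear functionals separate the points of a tensor power, identities between iterated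
coproducts are faithfully expressed through these contractions. -/
def sweedlerEval (W : WeakHopfData A) : (n : ℕ) → (Fin (n + 1) → (A →ₗ[ℂ] ℂ)) → (A →ₗ[ℂ] ℂ)
  | 0, φ => φ 0
  | n + 1, φ => papp (sweedlerEval W n (Fin.init φ)) (φ (Fin.last (n + 1))) ∘ₗ W.Δ

end WeakHopfData

/-- A `C*`-weak Hopf algebra together with its canonical distinguished elements:
the Haar integral `h`, the dual Haar integral `hHat`, the square roots `gL`, `gR` of
`E^L h`, `E^R h` (whence the canonical grouplike element `g = gL * gR⁻¹`), real powers
`gLpow`, `gRpow` of `gL` and `gR`, and a positive square root operation `sqrt`;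
all characterized by the (uniquely determining) properties listed as fields. -/
structure HaarPkg (A : Type*) [NormedRing A] [StarRing A] [CStarRing A]
    [NormedAlgebra ℂ A] [StarModule ℂ A] [FiniteDimensional ℂ A] : Type _ where
  W : WeakHopfData A
  /-- the Haar integral -/
  h : A
  haar_left : ∀ x : A, x * h = WeakHopfData.εL W x * h
  haar_right : ∀ x : A, h * x = h * WeakHopfData.εR W x
  haar_counitL : WeakHopfData.εL W h = 1
  haar_counitR : WeakHopfData.εR W h = 1
  haar_idem : h * h = h
  haar_star : star h = h
  haar_S : W.S h = h
  haar_nondeg : ∀ y : A, ∃ φ ψ : A →ₗ[ℂ] ℂ, lapp φ (W.Δ h) = y ∧ rapp ψ (W.Δ h) = y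
  /-- the Haar integral of the dual weak Hopf algebra `A*`, as a linear functional on `A` -/
  hHat : A →ₗ[ℂ] ℂ
  hHat_pos : ∀ x : A, ∃ r : ℝ, 0 ≤ r ∧ hHat (star x * x) = (r : ℂ)
  hHat_S : ∀ x : A, hHat (W.S x) = hHat x
  /-- `gL = (E^L h)^{1/2}` -/
  gL : A
  /-- `gR = (E^R h)^{1/2}` -/
  gR : A
  gL_pos : IsPosElem gL
  gR_pos : IsPosElem gR
  gL_unit : IsUnit gL
  gR_unit : IsUnit gR
  gL_sq : gL * gL = rapp hHat (W.Δ h)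
  gR_sq : gR * gR = lapp hHat (W.Δ h)
  gL_mem : gL ∈ Set.range (WeakHopfData.εL W)
  gR_mem : gR ∈ Set.range (WeakHopfData.εR W)
  gR_S : gR = W.S gL
  gLR_comm : gL * gR = gR * gL
  /-- the canonical grouplike element `g = gL * gR⁻¹` is positive -/
  g_pos : IsPosElem (gL * Ring.inverse gR)
  g_unit : IsUnit (gL * Ring.inverse gR)
  /-- `Δ g = (g ⊗ g) Δ 1` -/
  g_grouplike : W.Δ (gL * Ring.inverse gR)
      = ((gL * Ring.inverse gR) ⊗ₜ[ℂ] (gL * Ring.inverse gR)) * W.Δ 1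
  /-- `Δ g = Δ 1 (g ⊗ g)` -/
  g_grouplike' : W.Δ (gL * Ring.inverse gR)
      = W.Δ 1 * ((gL * Ring.inverse gR) ⊗ₜ[ℂ] (gL * Ring.inverse gR))
  /-- `S g = g⁻¹` -/
  g_S : W.S (gL * Ring.inverse gR) = Ring.inverse (gL * Ring.inverse gR)
  /-- `S² x = g x g⁻¹` -/
  S_sq : ∀ x : A,
      W.S (W.S x) = (gL * Ring.inverse gR) * x * Ring.inverse (gL * Ring.inverse gR)
  /-- `h₍₁₎ ⊗ g h₍₂₎ g = h₍₂₎ ⊗ h₍₁₎` -/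
  haar_flip : TensorProduct.map LinearMap.id
      (LinearMap.mulLeft ℂ (gL * Ring.inverse gR) ∘ₗ LinearMap.mulRight ℂ (gL * Ring.inverse gR))
      (W.Δ h) = (TensorProduct.comm ℂ A A) (W.Δ h)
  /-- dual integral relation `⟨ĥ, x (h gL⁻²)⟩ = ε x` -/
  hHat_dual₁ : ∀ x : A, hHat (x * (h * (Ring.inverse gL * Ring.inverse gL))) = W.ε x
  /-- dual integral relation `⟨ĥ, (gR⁻² h) x⟩ = ε x` -/
  hHat_dual₂ : ∀ x : A, hHat ((Ring.inverse gR * Ring.inverse gR * h) * x) = W.ε x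
  /-- dual integral relation `⟨ĥ, (h gL⁻²)₍₂₎⟩ (h gL⁻²)₍₁₎ = 1` -/
  hHat_dual₃ : rapp hHat (W.Δ (h * (Ring.inverse gL * Ring.inverse gL))) = 1
  /-- dual integral relation `⟨ĥ, (gR⁻² h)₍₁₎⟩ (gR⁻² h)₍₂₎ = 1` -/
  hHat_dual₄ : lapp hHat (W.Δ (Ring.inverse gR * Ring.inverse gR * h)) = 1
  /-- the positive square root, via the continuous functional calculus -/
  sqrt : A → A
  sqrt_pos : ∀ x : A, IsPosElem x → IsPosElem (sqrt x)
  sqrt_mul_self : ∀ x : A, IsPosElem x → sqrt x * sqrt x = x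
  /-- real powers of `gL`, via the continuous functional calculus -/
  gLpow : ℝ → A
  /-- real powers of `gR`, via the continuous functional calculus -/
  gRpow : ℝ → A
  gLpow_one : gLpow 1 = gL
  gRpow_one : gRpow 1 = gR
  gLpow_zero : gLpow 0 = 1
  gRpow_zero : gRpow 0 = 1
  gLpow_add : ∀ s t : ℝ, gLpow (s + t) = gLpow s * gLpow t
  gRpow_add : ∀ s t : ℝ, gRpow (s + t) = gRpow s * gRpow t
  gLpow_pos : ∀ t : ℝ, IsPosElem (gLpow t)
  gRpow_pos : ∀ t : ℝ, IsPosElem (gRpow t)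
  gLpow_continuous : Continuous gLpow
  gRpow_continuous : Continuous gRpow

namespace HaarPkg

variable {A : Type*} [NormedRing A] [StarRing A] [CStarRing A]
  [NormedAlgebra ℂ A] [StarModule ℂ A] [FiniteDimensional ℂ A]
variable (P : HaarPkg A)

/-- The canonical grouplike element `g = gL gR⁻¹`. -/
def g : A := P.gL * Ring.inverse P.gR

/-- The Watatani index `ı = ε^L (h gL⁻²)` of the Haar conditional expectations. -/
def iotaEl : A := WeakHopfData.εL P.W (P.h * (Ring.inverse P.gL * Ring.inverse P.gL))

/-- The element `ȷ = ⟨ĥ, (gL⁻²)₍₁₎⟩ (gL⁻²)₍₂₎`, the dual analogue of the Watatani index. -/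
def jayEl : A := lapp P.hHat (P.W.Δ (Ring.inverse P.gL * Ring.inverse P.gL))

/-- The pulling-through element `Ω = ı⁻¹ gL⁻¹ h gL⁻¹`. -/
def Ω : A := Ring.inverse P.iotaEl * Ring.inverse P.gL * P.h * Ring.inverse P.gL

/-- The map `J x = g^{-1/2} S(x) g^{1/2}`, as a linear map. -/
def Jlin : A →ₗ[ℂ] A :=
  LinearMap.mulRight ℂ (P.sqrt P.g) ∘ₗ
    LinearMap.mulLeft ℂ (Ring.inverse (P.sqrt P.g)) ∘ₗ P.W.S.toLinearMap

/-- The functional `⟨ω, x⟩ = ⟨ĥ, ȷ⁻¹ gL⁻¹ gR⁻¹ x⟩` (the dual analogue of `Ω`). -/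
def ω : A →ₗ[ℂ] ℂ :=
  P.hHat ∘ₗ LinearMap.mulLeft ℂ (Ring.inverse P.jayEl * (Ring.inverse P.gL * Ring.inverse P.gR))

/-- `ξ_L = ı^{1/2} ȷ^{1/2} gL`. -/
def ξL : A := P.sqrt P.iotaEl * P.sqrt P.jayEl * P.gL

/-- `ξ_R = ı^{1/2} ȷ^{1/2} gR`. -/
def ξR : A := P.sqrt P.iotaEl * P.sqrt P.jayEl * P.gR

/-- `ξ = ξ_L ξ_R`. -/
def ξ : A := P.ξL * P.ξR

/-- `J^L x = gL⁻¹ S(x) gL`. -/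
def JL : A → A := fun x => Ring.inverse P.gL * P.W.S x * P.gL

/-- `J^R x = gL S⁻¹(x) gL⁻¹`. -/
def JR : A → A := fun x => P.gL * P.W.S.symm x * Ring.inverse P.gL

end HaarPkg

section FunctionalCalculus

open Polynomial

/-- An element of a `ℂ`-algebra that is diagonalizable with positive eigenvalues, expressed
through a homomorphism from a finite power of `ℂ`. -/
def IsPosDiag {B : Type*} [Ring B] [Algebra ℂ B] (x : B) : Prop :=
  ∃ (ι : Type) (_ : Fintype ι) (μ : ι → ℝ) (φ : (ι → ℂ) →ₐ[ℂ] B),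
    (∀ i, 0 < μ i) ∧ x = φ fun i => (μ i : ℂ)

theorem spectrum_finite_of_finiteDimensional {B : Type*} [Ring B] [Algebra ℂ B]
    [FiniteDimensional ℂ B] (x : B) : (spectrum ℂ x).Finite := by
  refine ((minpoly ℂ x).rootSet_finite ℂ).subset fun z hz => ?_
  have hne : minpoly ℂ x ≠ 0 := minpoly.ne_zero (Algebra.IsIntegral.isIntegral x)
  have : Nontrivial B := by
    by_contra hB
    have := not_nontrivial_iff_subsingleton.1 hB
    simp [spectrum.of_subsingleton] at hz
  have hmem := spectrum.subset_polynomial_aeval x (minpoly ℂ x) ⟨z, hz, rfl⟩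
  rw [minpoly.aeval, spectrum.zero_eq] at hmem
  rw [mem_rootSet_of_ne hne, coe_aeval_eq_eval]
  exact hmem

theorem IsPosElem.isPosDiag {A : Type*} [NormedRing A] [StarRing A] [CStarRing A]
    [NormedAlgebra ℂ A] [StarModule ℂ A] [FiniteDimensional ℂ A] {s : A} (hs : IsPosElem s)
    (hu : IsUnit s) : IsPosDiag s := by
  obtain ⟨y, hy⟩ := hs
  have : CompleteSpace A := FiniteDimensional.complete ℂ A
  let _ : CStarAlgebra A := {}
  let _ := CStarAlgebra.spectralOrder A
  have := CStarAlgebra.spectralOrderedRing A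
  have hp : 0 ≤ s := hy ▸ star_mul_self_nonneg y
  have hsa : IsSelfAdjoint s := hp.isSelfAdjoint
  have hn : IsStarNormal s := hsa.isStarNormal
  have hfin : Finite (spectrum ℂ s) := spectrum_finite_of_finiteDimensional s
  have hpos : ∀ z ∈ spectrum ℂ s, 0 < z.re ∧ (z.re : ℂ) = z := fun z hz => by
    have hre : (z.re : ℂ) = z := (hsa.mem_spectrum_eq_re hz).symm
    have hmem : z.re ∈ spectrum ℝ s := by
      rw [← spectrum.algebraMap_mem_iff ℂ]
      simpa [hre] using hz
    refine ⟨lt_of_le_of_ne (spectrum_nonneg_of_nonneg hp hmem) fun h0 => ?_, hre⟩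
    exact spectrum.zero_notMem ℝ hu (h0 ▸ hmem)
  let ev : (spectrum ℂ s → ℂ) →ₐ[ℂ] C(spectrum ℂ s, ℂ) :=
    { toFun := fun f => ⟨f, continuous_of_discreteTopology⟩
      map_one' := rfl
      map_mul' := fun _ _ => rfl
      map_zero' := rfl
      map_add' := fun _ _ => rfl
      commutes' := fun _ => rfl }
  refine ⟨spectrum ℂ s, Fintype.ofFinite _, fun z => (z : ℂ).re,
    ((cfcHom hn : C(spectrum ℂ s, ℂ) →⋆ₐ[ℂ] A) : C(spectrum ℂ s, ℂ) →ₐ[ℂ] A).comp ev,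
    fun z => (hpos z z.2).1, ?_⟩
  have hid : ev (fun z => (((z : ℂ).re : ℝ) : ℂ)) = .restrict (spectrum ℂ s) (.id ℂ) := by
    ext z
    exact (hpos z z.2).2
  simp only [AlgHom.comp_apply, hid]
  exact (cfcHom_id hn).symm

namespace IsPosDiag

theorem one {B : Type*} [Ring B] [Algebra ℂ B] : IsPosDiag (1 : B) :=
  ⟨Unit, inferInstance, fun _ => 1, (Algebra.ofId ℂ B).comp (Pi.evalAlgHom ℂ _ ()),
    fun _ => one_pos, by simp⟩

theorem exists_inv {B : Type*} [Ring B] [Algebra ℂ B] {x : B} (hx : IsPosDiag x) :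
    ∃ y, IsPosDiag y ∧ x * y = 1 := by
  obtain ⟨ι, _, μ, φ, hμ, rfl⟩ := hx
  refine ⟨φ fun i => ((μ i)⁻¹ : ℝ), ⟨ι, inferInstance, _, φ, fun i => inv_pos.2 (hμ i), rfl⟩, ?_⟩
  rw [← map_mul, ← map_one φ]
  congr 1
  ext i
  simp [(hμ i).ne']

theorem tmul_self {B : Type*} [Ring B] [Algebra ℂ B] {x : B} (hx : IsPosDiag x) :
    IsPosDiag (x ⊗ₜ[ℂ] x) := by
  classical
  obtain ⟨ι, _, μ, φ, hμ, rfl⟩ := hx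
  let e := Algebra.TensorProduct.piScalarRight ℂ ℂ (ι → ℂ) ι
  let c : (ι × ι → ℂ) →ₐ[ℂ] (ι → ι → ℂ) :=
    { toFun := fun f i j => f (j, i)
      map_one' := rfl
      map_mul' := fun _ _ => rfl
      map_zero' := rfl
      map_add' := fun _ _ => rfl
      commutes' := fun _ => rfl }
  refine ⟨ι × ι, inferInstance, fun p => μ p.1 * μ p.2,
    (Algebra.TensorProduct.map φ φ).comp ((e.symm : _ →ₐ[ℂ] _).comp c),
    fun p => mul_pos (hμ _) (hμ _), ?_⟩
  have he : e ((fun i => (μ i : ℂ)) ⊗ₜ[ℂ] fun i => (μ i : ℂ)) =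
      c fun p => ((μ p.1 * μ p.2 : ℝ) : ℂ) := by
    ext i j
    change _ = ((μ j * μ i : ℝ) : ℂ)
    simp [e, mul_comm]
  simp only [AlgHom.comp_apply, ← he]
  simp

/-- A polynomial that agrees with the square root at sufficiently many points sends `x * x`
to `x`. -/
theorem exists_finset {B : Type*} [Ring B] [Algebra ℂ B] {x : B} (hx : IsPosDiag x) :
    ∃ F : Finset ℝ, (∀ r ∈ F, 0 < r) ∧
      ∀ p : ℂ[X], (∀ r ∈ F, p.eval ((r : ℂ) * r) = r) → aeval (x * x) p = x := by
  classical
  obtain ⟨ι, _, μ, φ, hμ, rfl⟩ := hx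
  refine ⟨Finset.univ.image μ, by simpa using hμ, fun p hp => ?_⟩
  rw [← map_mul, aeval_algHom_apply, aeval_pi_apply]
  congr 1
  ext i
  simpa using hp (μ i) (by simp)

theorem exists_polynomial (F : Finset ℝ) (hF : ∀ r ∈ F, 0 < r) :
    ∃ p : ℂ[X], ∀ r ∈ F, p.eval ((r : ℂ) * r) = r := by
  refine ⟨Lagrange.interpolate F (fun r : ℝ => (r : ℂ) * r) (fun r : ℝ => (r : ℂ)),
    fun r hr => Lagrange.eval_interpolate_at_node (v := fun r : ℝ => (r : ℂ) * r) _ ?_ hr⟩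
  intro a ha b hb hab
  have hab' : (a : ℂ) * a = b * b := hab
  have hab : a * a = b * b := by exact_mod_cast hab'
  exact (mul_self_inj (hF a ha).le (hF b hb).le).1 hab

/-- Finitely many diagonalizable elements with positive eigenvalues are recovered from their
squares by a common polynomial. -/
theorem exists_sqrt_polynomial {B C D : Type*} [Ring B] [Algebra ℂ B] [Ring C] [Algebra ℂ C]
    [Ring D] [Algebra ℂ D] {x : B} {y : C} {z : D} (hx : IsPosDiag x) (hy : IsPosDiag y)
    (hz : IsPosDiag z) :
    ∃ p : ℂ[X], aeval (x * x) p = x ∧ aeval (y * y) p = y ∧ aeval (z * z) p = z := by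
  classical
  obtain ⟨F, hF, hF'⟩ := hx.exists_finset
  obtain ⟨G, hG, hG'⟩ := hy.exists_finset
  obtain ⟨H, hH, hH'⟩ := hz.exists_finset
  obtain ⟨p, hp⟩ := exists_polynomial (F ∪ G ∪ H) (by
    simp only [Finset.mem_union]
    rintro r ((hr | hr) | hr)
    exacts [hF r hr, hG r hr, hH r hr])
  exact ⟨p, hF' p fun r hr => hp r (by simp [hr]), hG' p fun r hr => hp r (by simp [hr]),
    hH' p fun r hr => hp r (by simp [hr])⟩

end IsPosDiag

end FunctionalCalculus

section TensorTriples

variable {A : Type*} [NormedRing A] [NormedAlgebra ℂ A]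

theorem papp_tmul (φ ψ : A →ₗ[ℂ] ℂ) (a b : A) : papp φ ψ (a ⊗ₜ[ℂ] b) = φ a * ψ b := by
  simp [papp]

theorem papp_comm (φ ψ : A →ₗ[ℂ] ℂ) (u : A ⊗[ℂ] A) :
    papp φ ψ (TensorProduct.comm ℂ A A u) = papp ψ φ u := by
  induction u with
  | zero => simp
  | tmul a b => simp [papp_tmul, mul_comm]
  | add u v hu hv => simp only [map_add, hu, hv]

theorem papp_comp (φ ψ : A →ₗ[ℂ] ℂ) (f g : A →ₗ[ℂ] A) (u : A ⊗[ℂ] A) :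
    papp (φ ∘ₗ f) (ψ ∘ₗ g) u = papp φ ψ (TensorProduct.map f g u) := by
  induction u with
  | zero => simp
  | tmul a b => simp [papp_tmul]
  | add u v hu hv => simp only [map_add, hu, hv]

theorem comm_mul (u v : A ⊗[ℂ] A) : TensorProduct.comm ℂ A A (u * v) =
    TensorProduct.comm ℂ A A u * TensorProduct.comm ℂ A A v :=
  map_mul (Algebra.TensorProduct.comm ℂ A A) u v

end TensorTriples

namespace WeakHopfData

variable {A : Type*} [NormedRing A] [StarRing A] [CStarRing A]
  [NormedAlgebra ℂ A] [StarModule ℂ A] [FiniteDimensional ℂ A]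
variable (W : WeakHopfData A)

theorem S_one : W.S 1 = 1 := by
  obtain ⟨x, hx⟩ := W.S.surjective 1
  have := W.S_antimul x 1
  rwa [mul_one, hx, mul_one, eq_comm] at this

theorem Δ_one_mul (x : A) : W.Δ 1 * W.Δ x = W.Δ x := by rw [← W.Δ_mul, one_mul]

theorem Δ_mul_one (x : A) : W.Δ x * W.Δ 1 = W.Δ x := by rw [← W.Δ_mul, mul_one]

theorem εL_eq_lapp (x : A) : W.εL x = lapp (W.ε ∘ₗ LinearMap.mulRight ℂ x) (W.Δ 1) :=
  W.antipode_left x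

theorem εR_eq_rapp (x : A) : W.εR x = rapp (W.ε ∘ₗ LinearMap.mulLeft ℂ x) (W.Δ 1) :=
  W.antipode_right x

theorem εL_one : W.εL 1 = 1 := by
  rw [εL_eq_lapp]
  simpa [lapp, LinearMap.mulRight_one] using LinearMap.congr_fun W.counit_left 1

theorem εR_one : W.εR 1 = 1 := by
  rw [εR_eq_rapp]
  simpa [rapp, LinearMap.mulLeft_one] using LinearMap.congr_fun W.counit_right 1

theorem coassoc_apply (x : A) :
    TensorProduct.assoc ℂ A A A (TensorProduct.map W.Δ LinearMap.id (W.Δ x)) =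
      TensorProduct.map LinearMap.id W.Δ (W.Δ x) :=
  LinearMap.congr_fun W.coassoc x

/-- `l` behaves as an element of `A^L` under the comultiplication. -/
def IsLeft (l : A) : Prop :=
  W.Δ l = (l ⊗ₜ[ℂ] 1) * W.Δ 1 ∧ W.Δ l = W.Δ 1 * (l ⊗ₜ[ℂ] 1)

/-- `r` behaves as an element of `A^R` under the comultiplication. -/
def IsRight (r : A) : Prop :=
  W.Δ r = (1 ⊗ₜ[ℂ] r) * W.Δ 1 ∧ W.Δ r = W.Δ 1 * (1 ⊗ₜ[ℂ] r)

theorem isLeft_εL (x : A) : W.IsLeft (W.εL x) := by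
  have key (u : A ⊗[ℂ] A) : W.Δ (lapp (W.ε ∘ₗ LinearMap.mulRight ℂ x) u) =
      (TensorProduct.lid ℂ (A ⊗[ℂ] A)) (TensorProduct.map (W.ε ∘ₗ LinearMap.mulRight ℂ x)
        LinearMap.id (TensorProduct.map LinearMap.id W.Δ u)) := by
    induction u with
    | zero => simp
    | tmul a b => simp [lapp]
    | add u v hu hv => simp only [map_add, hu, hv]
  constructor
  · rw [εL_eq_lapp, key, ← coassoc_apply, W.Δ_one_weak]
    generalize W.Δ 1 = u
    suffices H : ∀ v : A ⊗[ℂ] A, (TensorProduct.lid ℂ (A ⊗[ℂ] A))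
        (TensorProduct.map (W.ε ∘ₗ LinearMap.mulRight ℂ x) LinearMap.id
          (TensorProduct.assoc ℂ A A A ((u ⊗ₜ[ℂ] (1 : A)) *
            (TensorProduct.assoc ℂ A A A).symm ((1 : A) ⊗ₜ[ℂ] v)))) =
        (lapp (W.ε ∘ₗ LinearMap.mulRight ℂ x) u ⊗ₜ[ℂ] 1) * v from H u
    intro v
    induction u with
    | zero => simp
    | add u u' hu hu' => simp only [TensorProduct.add_tmul, add_mul, map_add, hu, hu']
    | tmul a b =>
      induction v with
      | zero => simp
      | add v v' hv hv' => simp only [TensorProduct.tmul_add, mul_add, map_add, hv, hv']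
      | tmul c d => simp [lapp, TensorProduct.smul_tmul']
  · rw [εL_eq_lapp, key, ← coassoc_apply, W.Δ_one_weak']
    generalize W.Δ 1 = u
    suffices H : ∀ v : A ⊗[ℂ] A, (TensorProduct.lid ℂ (A ⊗[ℂ] A))
        (TensorProduct.map (W.ε ∘ₗ LinearMap.mulRight ℂ x) LinearMap.id
          (TensorProduct.assoc ℂ A A A ((TensorProduct.assoc ℂ A A A).symm ((1 : A) ⊗ₜ[ℂ] v) *
            (u ⊗ₜ[ℂ] (1 : A))))) =
        v * (lapp (W.ε ∘ₗ LinearMap.mulRight ℂ x) u ⊗ₜ[ℂ] 1) from H u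
    intro v
    induction u with
    | zero => simp
    | add u u' hu hu' => simp only [TensorProduct.add_tmul, mul_add, map_add, hu, hu']
    | tmul a b =>
      induction v with
      | zero => simp
      | add v v' hv hv' => simp only [TensorProduct.tmul_add, add_mul, map_add, hv, hv']
      | tmul c d => simp [lapp, TensorProduct.smul_tmul']

variable {W}

theorem map_S_mul (u v : A ⊗[ℂ] A) :
    TensorProduct.map W.S.toLinearMap W.S.toLinearMap (u * v) =
      TensorProduct.map W.S.toLinearMap W.S.toLinearMap v *
        TensorProduct.map W.S.toLinearMap W.S.toLinearMap u := by
  induction u with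
  | zero => simp
  | add u u' hu hu' => simp only [add_mul, mul_add, map_add, hu, hu']
  | tmul a b =>
    induction v with
    | zero => simp
    | add v v' hv hv' => simp only [add_mul, mul_add, map_add, hv, hv']
    | tmul c d => simp [W.S_antimul]

theorem IsLeft.S {l : A} (hl : W.IsLeft l) : W.IsRight (W.S l) := by
  have h1 : TensorProduct.comm ℂ A A
      (TensorProduct.map W.S.toLinearMap W.S.toLinearMap (W.Δ 1)) = W.Δ 1 := by
    rw [← W.S_anticomul, W.S_one]
  constructor
  · rw [W.S_anticomul, hl.2, map_S_mul, comm_mul, h1]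
    simp [W.S_one]
  · rw [W.S_anticomul, hl.1, map_S_mul, comm_mul, h1]
    simp [W.S_one]

theorem IsLeft.inverse {l : A} (hl : W.IsLeft l) (hu : IsUnit l) :
    W.IsLeft (Ring.inverse l) := by
  constructor
  · calc W.Δ (Ring.inverse l)
        = ((Ring.inverse l * l) ⊗ₜ[ℂ] 1) * (W.Δ 1 * W.Δ (Ring.inverse l)) := by
          rw [Ring.inverse_mul_cancel _ hu, Δ_one_mul, ← Algebra.TensorProduct.one_def, one_mul]
      _ = (Ring.inverse l ⊗ₜ[ℂ] 1) * (((l ⊗ₜ[ℂ] 1) * W.Δ 1) * W.Δ (Ring.inverse l)) := by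
          simp only [← mul_assoc, Algebra.TensorProduct.tmul_mul_tmul, one_mul]
      _ = _ := by rw [← hl.1, ← W.Δ_mul, Ring.mul_inverse_cancel _ hu]
  · calc W.Δ (Ring.inverse l)
        = (W.Δ (Ring.inverse l) * W.Δ 1) * ((l * Ring.inverse l) ⊗ₜ[ℂ] 1) := by
          rw [Ring.mul_inverse_cancel _ hu, Δ_mul_one, ← Algebra.TensorProduct.one_def, mul_one]
      _ = (W.Δ (Ring.inverse l) * (W.Δ 1 * (l ⊗ₜ[ℂ] 1))) * (Ring.inverse l ⊗ₜ[ℂ] 1) := by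
          simp only [mul_assoc, Algebra.TensorProduct.tmul_mul_tmul, one_mul]
      _ = _ := by rw [← hl.2, ← W.Δ_mul, Ring.inverse_mul_cancel _ hu]

theorem IsRight.inverse {r : A} (hr : W.IsRight r) (hu : IsUnit r) :
    W.IsRight (Ring.inverse r) := by
  constructor
  · calc W.Δ (Ring.inverse r)
        = (1 ⊗ₜ[ℂ] (Ring.inverse r * r)) * (W.Δ 1 * W.Δ (Ring.inverse r)) := by
          rw [Ring.inverse_mul_cancel _ hu, Δ_one_mul, ← Algebra.TensorProduct.one_def, one_mul]
      _ = (1 ⊗ₜ[ℂ] Ring.inverse r) * (((1 ⊗ₜ[ℂ] r) * W.Δ 1) * W.Δ (Ring.inverse r)) := by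
          simp only [← mul_assoc, Algebra.TensorProduct.tmul_mul_tmul, one_mul]
      _ = _ := by rw [← hr.1, ← W.Δ_mul, Ring.mul_inverse_cancel _ hu]
  · calc W.Δ (Ring.inverse r)
        = (W.Δ (Ring.inverse r) * W.Δ 1) * (1 ⊗ₜ[ℂ] (r * Ring.inverse r)) := by
          rw [Ring.mul_inverse_cancel _ hu, Δ_mul_one, ← Algebra.TensorProduct.one_def, mul_one]
      _ = (W.Δ (Ring.inverse r) * (W.Δ 1 * (1 ⊗ₜ[ℂ] r))) * (1 ⊗ₜ[ℂ] Ring.inverse r) := by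
          simp only [mul_assoc, Algebra.TensorProduct.tmul_mul_tmul, one_mul]
      _ = _ := by rw [← hr.2, ← W.Δ_mul, Ring.inverse_mul_cancel _ hu]

theorem IsLeft.Δ_mul_left {l : A} (hl : W.IsLeft l) (x : A) :
    W.Δ (l * x) = (l ⊗ₜ[ℂ] 1) * W.Δ x := by
  rw [W.Δ_mul, hl.1, mul_assoc, Δ_one_mul]

theorem IsLeft.Δ_mul_right {l : A} (hl : W.IsLeft l) (x : A) :
    W.Δ (x * l) = W.Δ x * (l ⊗ₜ[ℂ] 1) := by
  rw [W.Δ_mul, hl.2, ← mul_assoc, Δ_mul_one]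

theorem IsRight.Δ_mul_left {r : A} (hr : W.IsRight r) (x : A) :
    W.Δ (r * x) = (1 ⊗ₜ[ℂ] r) * W.Δ x := by
  rw [W.Δ_mul, hr.1, mul_assoc, Δ_one_mul]

theorem IsRight.Δ_mul_right {r : A} (hr : W.IsRight r) (x : A) :
    W.Δ (x * r) = W.Δ x * (1 ⊗ₜ[ℂ] r) := by
  rw [W.Δ_mul, hr.2, ← mul_assoc, Δ_mul_one]

theorem IsLeft.εR_eq {l : A} (hl : W.IsLeft l) : W.εR l = W.S l := by
  have key (u : A ⊗[ℂ] A) : LinearMap.mul' ℂ A (TensorProduct.map W.S.toLinearMap LinearMap.id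
      (u * (l ⊗ₜ[ℂ] 1))) =
      W.S l * LinearMap.mul' ℂ A (TensorProduct.map W.S.toLinearMap LinearMap.id u) := by
    induction u with
    | zero => simp
    | add u v hu hv => simp only [add_mul, mul_add, map_add, hu, hv]
    | tmul a b => simp [W.S_antimul, mul_assoc]
  have h1 : LinearMap.mul' ℂ A (TensorProduct.map W.S.toLinearMap LinearMap.id (W.Δ 1)) = 1 :=
    W.εR_one
  calc W.εR l = LinearMap.mul' ℂ A (TensorProduct.map W.S.toLinearMap LinearMap.id (W.Δ l)) := rfl
    _ = W.S l := by rw [hl.2, key, h1, mul_one]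

theorem IsRight.εL_eq {r : A} (hr : W.IsRight r) : W.εL r = W.S r := by
  have key (u : A ⊗[ℂ] A) : LinearMap.mul' ℂ A (TensorProduct.map LinearMap.id W.S.toLinearMap
      ((1 ⊗ₜ[ℂ] r) * u)) =
      LinearMap.mul' ℂ A (TensorProduct.map LinearMap.id W.S.toLinearMap u) * W.S r := by
    induction u with
    | zero => simp
    | add u v hu hv => simp only [add_mul, mul_add, map_add, hu, hv]
    | tmul a b => simp [W.S_antimul, mul_assoc]
  have h1 : LinearMap.mul' ℂ A (TensorProduct.map LinearMap.id W.S.toLinearMap (W.Δ 1)) = 1 :=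
    W.εL_one
  calc W.εL r = LinearMap.mul' ℂ A (TensorProduct.map LinearMap.id W.S.toLinearMap (W.Δ r)) := rfl
    _ = W.S r := by rw [hr.1, key, h1, one_mul]

variable (W)

/-- `x₍₁₎ ⊗ ε^L(x₍₂₎) = 1₍₁₎ x ⊗ 1₍₂₎`. -/
theorem map_id_εL_Δ (x : A) :
    TensorProduct.map LinearMap.id W.εL (W.Δ x) = W.Δ 1 * (x ⊗ₜ[ℂ] 1) := by
  let Φ : (A ⊗[ℂ] A) ⊗[ℂ] A →ₗ[ℂ] A ⊗[ℂ] A := TensorProduct.map (rapp W.ε) LinearMap.id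
  have hΦ (u : A ⊗[ℂ] A) : Φ (TensorProduct.map W.Δ LinearMap.id u) = u := by
    induction u with
    | zero => simp
    | add u v hu hv => simp only [map_add, hu, hv]
    | tmul a b =>
      have : rapp W.ε (W.Δ a) = a := LinearMap.congr_fun W.counit_right a
      simp [Φ, this]
  have hmul (u : A ⊗[ℂ] A) : TensorProduct.map W.Δ LinearMap.id (u * (x ⊗ₜ[ℂ] 1)) =
      TensorProduct.map W.Δ LinearMap.id u * (W.Δ x ⊗ₜ[ℂ] 1) := by
    induction u with
    | zero => simp
    | add u v hu hv => simp only [add_mul, map_add, hu, hv]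
    | tmul a b => simp [W.Δ_mul]
  have hv (v : A ⊗[ℂ] A) : Φ ((TensorProduct.assoc ℂ A A A).symm ((1 : A) ⊗ₜ[ℂ] W.Δ 1) *
      (v ⊗ₜ[ℂ] (1 : A))) = TensorProduct.map LinearMap.id W.εL v := by
    induction v with
    | zero => simp
    | add v v' hv hv' => simp only [TensorProduct.add_tmul, mul_add, map_add, hv, hv']
    | tmul a b =>
      simp only [TensorProduct.map_tmul, εL_eq_lapp, LinearMap.id_apply]
      generalize W.Δ 1 = u
      induction u with
      | zero => simp
      | add u u' hu hu' => simp only [TensorProduct.tmul_add, add_mul, map_add, hu, hu']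
      | tmul c d => simp [Φ, lapp, rapp, TensorProduct.smul_tmul]
  rw [← hΦ (W.Δ 1 * _), hmul, W.Δ_one_weak', mul_assoc, Algebra.TensorProduct.tmul_mul_tmul,
    Δ_one_mul, one_mul, hv]

/-- `ε^R(x₍₁₎) ⊗ x₍₂₎ = 1₍₁₎ ⊗ x 1₍₂₎`. -/
theorem map_εR_id_Δ (x : A) :
    TensorProduct.map W.εR LinearMap.id (W.Δ x) = (1 ⊗ₜ[ℂ] x) * W.Δ 1 := by
  let Φ : A ⊗[ℂ] (A ⊗[ℂ] A) →ₗ[ℂ] A ⊗[ℂ] A := TensorProduct.map LinearMap.id (lapp W.ε)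
  have hΦ (u : A ⊗[ℂ] A) : Φ (TensorProduct.map LinearMap.id W.Δ u) = u := by
    induction u with
    | zero => simp
    | add u v hu hv => simp only [map_add, hu, hv]
    | tmul a b =>
      have : lapp W.ε (W.Δ b) = b := LinearMap.congr_fun W.counit_left b
      simp [Φ, this]
  have hmul (u : A ⊗[ℂ] A) : TensorProduct.map LinearMap.id W.Δ ((1 ⊗ₜ[ℂ] x) * u) =
      (1 ⊗ₜ[ℂ] W.Δ x) * TensorProduct.map LinearMap.id W.Δ u := by
    induction u with
    | zero => simp
    | add u v hu hv => simp only [mul_add, map_add, hu, hv]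
    | tmul a b => simp [W.Δ_mul]
  have hassoc (s t : (A ⊗[ℂ] A) ⊗[ℂ] A) : TensorProduct.assoc ℂ A A A (s * t) =
      TensorProduct.assoc ℂ A A A s * TensorProduct.assoc ℂ A A A t :=
    map_mul (Algebra.TensorProduct.assoc ℂ ℂ ℂ A A A) s t
  have hv (v : A ⊗[ℂ] A) : Φ (((1 : A) ⊗ₜ[ℂ] v) *
      TensorProduct.assoc ℂ A A A (W.Δ 1 ⊗ₜ[ℂ] (1 : A))) =
        TensorProduct.map W.εR LinearMap.id v := by
    induction v with
    | zero => simp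
    | add v v' hv hv' => simp only [TensorProduct.tmul_add, add_mul, map_add, hv, hv']
    | tmul a b =>
      simp only [TensorProduct.map_tmul, εR_eq_rapp, LinearMap.id_apply]
      generalize W.Δ 1 = u
      induction u with
      | zero => simp
      | add u u' hu hu' => simp only [TensorProduct.add_tmul, mul_add, map_add, hu, hu']
      | tmul c d => simp [Φ, lapp, rapp, TensorProduct.smul_tmul]
  rw [← hΦ (_ * W.Δ 1), hmul, ← coassoc_apply, W.Δ_one_weak', hassoc,
    LinearEquiv.apply_symm_apply, ← mul_assoc, Algebra.TensorProduct.tmul_mul_tmul,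
    Δ_mul_one, one_mul, hv]

/-- `S(x₍₁₎) ε^L(x₍₂₎) = S(x)`. -/
theorem S_mul_εL (x : A) :
    LinearMap.mul' ℂ A (TensorProduct.map W.S.toLinearMap W.εL (W.Δ x)) = W.S x := by
  have hcomp : TensorProduct.map W.S.toLinearMap W.εL (W.Δ x) =
      TensorProduct.map W.S.toLinearMap LinearMap.id
        (TensorProduct.map LinearMap.id W.εL (W.Δ x)) := by
    rw [TensorProduct.map_map, LinearMap.comp_id, LinearMap.id_comp]
  have key (u : A ⊗[ℂ] A) : LinearMap.mul' ℂ A (TensorProduct.map W.S.toLinearMap LinearMap.id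
      (u * (x ⊗ₜ[ℂ] 1))) =
      W.S x * LinearMap.mul' ℂ A (TensorProduct.map W.S.toLinearMap LinearMap.id u) := by
    induction u with
    | zero => simp
    | add u v hu hv => simp only [add_mul, mul_add, map_add, hu, hv]
    | tmul a b => simp [W.S_antimul, mul_assoc]
  have h1 : LinearMap.mul' ℂ A (TensorProduct.map W.S.toLinearMap LinearMap.id (W.Δ 1)) = 1 :=
    W.εR_one
  rw [hcomp, map_id_εL_Δ, key, h1, mul_one]

/-- A left integral `h` satisfies `S(x) h₍₁₎ ⊗ h₍₂₎ = h₍₁₎ ⊗ x h₍₂₎`. -/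
theorem S_tmul_mul_Δ {h : A} (hh : ∀ x, x * h = W.εL x * h) (x : A) :
    (W.S x ⊗ₜ[ℂ] 1) * W.Δ h = (1 ⊗ₜ[ℂ] x) * W.Δ h := by
  let M : (A ⊗[ℂ] A) ⊗[ℂ] A →ₗ[ℂ] A ⊗[ℂ] A :=
    TensorProduct.map (LinearMap.mul' ℂ A ∘ₗ TensorProduct.map W.S.toLinearMap LinearMap.id)
      LinearMap.id
  have h₁ (v : A ⊗[ℂ] A) : M (TensorProduct.map W.Δ LinearMap.id v) =
      TensorProduct.map W.εR LinearMap.id v := by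
    rw [← LinearMap.comp_apply, ← TensorProduct.map_comp]
    rfl
  have h₂ (a : A) (w : A ⊗[ℂ] A) :
      M ((TensorProduct.assoc ℂ A A A).symm (a ⊗ₜ[ℂ] w)) = (W.S a ⊗ₜ[ℂ] 1) * w := by
    induction w with
    | zero => simp
    | add u v hu hv => simp only [TensorProduct.tmul_add, mul_add, map_add, hu, hv]
    | tmul b c => simp [M]
  have h₃ (v : A ⊗[ℂ] A) : M ((TensorProduct.assoc ℂ A A A).symm
      (TensorProduct.map LinearMap.id W.Δ v)) * W.Δ h =
      (LinearMap.mul' ℂ A (TensorProduct.map W.S.toLinearMap W.εL v) ⊗ₜ[ℂ] 1) * W.Δ h := by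
    induction v with
    | zero => simp
    | add u v hu hv => simp only [TensorProduct.add_tmul, add_mul, map_add, hu, hv]
    | tmul a b =>
      rw [TensorProduct.map_tmul, LinearMap.id_apply, h₂, mul_assoc, ← W.Δ_mul, hh,
        (W.isLeft_εL b).Δ_mul_left, ← mul_assoc]
      simp
  rw [← S_mul_εL, ← h₃, ← coassoc_apply, LinearEquiv.symm_apply_apply, h₁, map_εR_id_Δ,
    mul_assoc, Δ_one_mul]

end WeakHopfData

theorem commute_inverse_right {M : Type*} [MonoidWithZero M] {a b : M} (hab : Commute a b) :
    Commute a (Ring.inverse b) := by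
  by_cases hb : IsUnit b
  · obtain ⟨u, rfl⟩ := hb
    rw [Ring.inverse_unit]
    exact hab.units_inv_right
  · rw [Ring.inverse_non_unit _ hb]
    exact Commute.zero_right a

namespace WeakHopfData

variable {A : Type*} [NormedRing A] [StarRing A] [CStarRing A]
  [NormedAlgebra ℂ A] [StarModule ℂ A] [FiniteDimensional ℂ A]
variable (W : WeakHopfData A)

theorem S_aeval (p : Polynomial ℂ) (x : A) :
    W.S (Polynomial.aeval x p) = Polynomial.aeval (W.S x) p := by
  have hpow (n : ℕ) : W.S (x ^ n) = W.S x ^ n := by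
    induction n with
    | zero => simp [W.S_one]
    | succ n ih => rw [pow_succ, W.S_antimul, ih, pow_succ']
  simp [Polynomial.aeval_eq_sum_range, hpow]

/-- Polynomials of a grouplike element `g`. -/
theorem Δ_aeval {g : A} (hg : W.Δ g = (g ⊗ₜ[ℂ] g) * W.Δ 1) (p : Polynomial ℂ) :
    W.Δ (Polynomial.aeval g p) = Polynomial.aeval (g ⊗ₜ[ℂ] g) p * W.Δ 1 := by
  have hpow (n : ℕ) : W.Δ (g ^ n) = (g ⊗ₜ[ℂ] g) ^ n * W.Δ 1 := by
    induction n with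
    | zero => simp
    | succ n ih => rw [pow_succ', W.Δ_mul, hg, mul_assoc, Δ_one_mul, ih, pow_succ', mul_assoc]
  simp [Polynomial.aeval_eq_sum_range, hpow, Finset.sum_mul]

theorem Δ_aeval' {g : A} (hg : W.Δ g = W.Δ 1 * (g ⊗ₜ[ℂ] g)) (p : Polynomial ℂ) :
    W.Δ (Polynomial.aeval g p) = W.Δ 1 * Polynomial.aeval (g ⊗ₜ[ℂ] g) p := by
  have hpow (n : ℕ) : W.Δ (g ^ n) = W.Δ 1 * (g ⊗ₜ[ℂ] g) ^ n := by
    induction n with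
    | zero => simp
    | succ n ih => rw [pow_succ, W.Δ_mul, hg, ← mul_assoc, Δ_mul_one, ih, pow_succ, mul_assoc]
  simp [Polynomial.aeval_eq_sum_range, hpow, Finset.mul_sum]

theorem papp_coassoc (α β γ : A →ₗ[ℂ] ℂ) (x : A) :
    papp (papp α β ∘ₗ W.Δ) γ (W.Δ x) = papp α (papp β γ ∘ₗ W.Δ) (W.Δ x) := by
  let T : A ⊗[ℂ] (A ⊗[ℂ] A) →ₗ[ℂ] ℂ :=
    (TensorProduct.lid ℂ ℂ).toLinearMap ∘ₗ TensorProduct.map α (papp β γ)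
  have hr (u : A ⊗[ℂ] A) : papp α (papp β γ ∘ₗ W.Δ) u =
      T (TensorProduct.map LinearMap.id W.Δ u) := by
    induction u with
    | zero => simp
    | add u v hu hv => simp only [map_add, hu, hv]
    | tmul a b => simp [papp_tmul, T]
  have hl (u : A ⊗[ℂ] A) : papp (papp α β ∘ₗ W.Δ) γ u =
      T (TensorProduct.assoc ℂ A A A (TensorProduct.map W.Δ LinearMap.id u)) := by
    induction u with
    | zero => simp
    | add u v hu hv => simp only [map_add, hu, hv]
    | tmul a b =>
      simp only [papp_tmul, LinearMap.comp_apply, TensorProduct.map_tmul, LinearMap.id_apply]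
      generalize W.Δ a = w
      induction w with
      | zero => simp
      | add u v hu hv => simp only [TensorProduct.add_tmul, add_mul, map_add, hu, hv]
      | tmul c d => simp [papp_tmul, T, mul_assoc]
  rw [hl, hr, coassoc_apply]

theorem sweedlerEval_succ (n : ℕ) (φ : Fin (n + 2) → (A →ₗ[ℂ] ℂ)) :
    W.sweedlerEval (n + 1) φ =
      papp (W.sweedlerEval n (Fin.init φ)) (φ (Fin.last (n + 1))) ∘ₗ W.Δ := rfl

/-- The iterated coproduct may be computed by splitting off the first leg. -/
theorem sweedlerEval_succ' (n : ℕ) (φ : Fin (n + 2) → (A →ₗ[ℂ] ℂ)) :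
    W.sweedlerEval (n + 1) φ = papp (φ 0) (W.sweedlerEval n (Fin.tail φ)) ∘ₗ W.Δ := by
  induction n with
  | zero => rfl
  | succ n ih =>
    rw [sweedlerEval_succ, ih]
    ext x
    exact W.papp_coassoc _ _ _ x

/-- An anticomultiplicative map reverses the legs of the iterated coproduct. -/
theorem sweedlerEval_comp_anti {J : A →ₗ[ℂ] A}
    (hJ : ∀ x, W.Δ (J x) = TensorProduct.comm ℂ A A (TensorProduct.map J J (W.Δ x)))
    (n : ℕ) (φ : Fin (n + 1) → (A →ₗ[ℂ] ℂ)) :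
    W.sweedlerEval n (fun k => φ k ∘ₗ J) = W.sweedlerEval n (fun k => φ k.rev) ∘ₗ J := by
  induction n with
  | zero => rfl
  | succ n ih =>
    have hinit : Fin.init (fun k => φ k ∘ₗ J) = fun k => Fin.init φ k ∘ₗ J := rfl
    have htail : Fin.tail (fun k => φ k.rev) = fun k => Fin.init φ k.rev := by
      ext k : 1
      simp [Fin.tail, Fin.init, Fin.rev_succ]
    ext x
    rw [sweedlerEval_succ, hinit, ih, sweedlerEval_succ', htail]
    simp only [LinearMap.comp_apply, hJ, papp_comm, papp_comp, Fin.rev_zero]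

/-- Cyclic invariance of the iterated coproduct of a cocentral element. -/
theorem sweedlerEval_cyclic {x : A} (hx : TensorProduct.comm ℂ A A (W.Δ x) = W.Δ x) (n : ℕ)
    (φ : Fin (n + 2) → (A →ₗ[ℂ] ℂ)) :
    W.sweedlerEval (n + 1) (Fin.snoc (α := fun _ => A →ₗ[ℂ] ℂ) (Fin.tail φ) (φ 0)) x =
      W.sweedlerEval (n + 1) φ x := by
  rw [sweedlerEval_succ, sweedlerEval_succ', Fin.init_snoc, Fin.snoc_last, LinearMap.comp_apply,
    LinearMap.comp_apply, ← papp_comm, hx]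

end WeakHopfData

namespace HaarPkg

variable {A : Type*} [NormedRing A] [StarRing A] [CStarRing A]
  [NormedAlgebra ℂ A] [StarModule ℂ A] [FiniteDimensional ℂ A]
variable (P : HaarPkg A)

theorem isLeft_gL : P.W.IsLeft P.gL := by
  obtain ⟨x, hx⟩ := P.gL_mem
  exact hx ▸ P.W.isLeft_εL x

theorem isRight_gR : P.W.IsRight P.gR := P.gR_S ▸ P.isLeft_gL.S

theorem isLeft_inverse_gL : P.W.IsLeft (Ring.inverse P.gL) := P.isLeft_gL.inverse P.gL_unit

theorem isRight_inverse_gR : P.W.IsRight (Ring.inverse P.gR) := P.isRight_gR.inverse P.gR_unit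

theorem S_inverse {x : A} (hx : IsUnit x) : P.W.S (Ring.inverse x) = Ring.inverse (P.W.S x) := by
  have h1 : P.W.S (Ring.inverse x) * P.W.S x = 1 := by
    rw [← P.W.S_antimul, Ring.mul_inverse_cancel _ hx, P.W.S_one]
  have h2 : P.W.S x * P.W.S (Ring.inverse x) = 1 := by
    rw [← P.W.S_antimul, Ring.inverse_mul_cancel _ hx, P.W.S_one]
  have hu : IsUnit (P.W.S x) := ⟨⟨_, _, h2, h1⟩, rfl⟩
  rw [← mul_one (P.W.S (Ring.inverse x)), ← Ring.mul_inverse_cancel _ hu, ← mul_assoc, h1,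
    one_mul]

theorem commute_gL_g : Commute P.gL P.g :=
  (Commute.refl _).mul_right (commute_inverse_right P.gLR_comm)

theorem commute_gR_g : Commute P.gR P.g :=
  Commute.mul_right (show Commute P.gL P.gR from P.gLR_comm).symm
    (commute_inverse_right (Commute.refl P.gR))

theorem isUnit_g : IsUnit P.g := P.g_unit

theorem S_gR : P.W.S P.gR = P.gL := by
  rw [P.gR_S, P.S_sq]
  change P.g * P.gL * Ring.inverse P.g = P.gL
  rw [← P.commute_gL_g.eq, mul_assoc, Ring.mul_inverse_cancel _ P.isUnit_g, mul_one]

theorem h_mul_gL : P.h * P.gL = P.h * P.gR := by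
  rw [P.haar_right P.gL, P.isLeft_gL.εR_eq, P.gR_S]

theorem gR_mul_h : P.gR * P.h = P.gL * P.h := by
  rw [P.haar_left P.gR, P.isRight_gR.εL_eq, P.S_gR]

theorem h_mul_inverse : P.h * Ring.inverse P.gR = P.h * Ring.inverse P.gL := by
  have hc : Commute (Ring.inverse P.gL) (Ring.inverse P.gR) :=
    (show Commute P.gL P.gR from P.gLR_comm).ringInverse_ringInverse
  calc P.h * Ring.inverse P.gR = P.h * P.gL * (Ring.inverse P.gL * Ring.inverse P.gR) := by
        rw [mul_assoc, ← mul_assoc P.gL, Ring.mul_inverse_cancel _ P.gL_unit, one_mul]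
    _ = P.h * Ring.inverse P.gL := by
        rw [h_mul_gL, hc.eq, mul_assoc, ← mul_assoc P.gR, Ring.mul_inverse_cancel _ P.gR_unit,
          one_mul]

theorem inverse_mul_h : Ring.inverse P.gR * P.h = Ring.inverse P.gL * P.h := by
  have hc : Commute (Ring.inverse P.gL) (Ring.inverse P.gR) :=
    (show Commute P.gL P.gR from P.gLR_comm).ringInverse_ringInverse
  calc Ring.inverse P.gR * P.h = (Ring.inverse P.gR * Ring.inverse P.gL) * (P.gL * P.h) := by
        rw [mul_assoc, ← mul_assoc _ P.gL, Ring.inverse_mul_cancel _ P.gL_unit, one_mul]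
    _ = Ring.inverse P.gL * P.h := by
        rw [← gR_mul_h, ← hc.eq, mul_assoc, ← mul_assoc _ P.gR,
          Ring.inverse_mul_cancel _ P.gR_unit, one_mul]

theorem g_mul_h : P.g * P.h = P.h := by
  rw [g, mul_assoc, inverse_mul_h, ← mul_assoc, Ring.mul_inverse_cancel _ P.gL_unit, one_mul]

theorem h_mul_g : P.h * P.g = P.h := by
  rw [g, ← mul_assoc, h_mul_gL, mul_assoc, Ring.mul_inverse_cancel _ P.gR_unit, mul_one]

/-! ### The square root of the grouplike element -/

theorem sqrt_g_mul_self : P.sqrt P.g * P.sqrt P.g = P.g := P.sqrt_mul_self _ P.g_pos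

theorem isUnit_sqrt_g : IsUnit (P.sqrt P.g) := by
  rw [← isUnit_pow_iff two_ne_zero, sq, sqrt_g_mul_self]
  exact P.isUnit_g

theorem inverse_g : Ring.inverse P.g = Ring.inverse (P.sqrt P.g) * Ring.inverse (P.sqrt P.g) := by
  have := Ring.mul_inverse_rev' (Commute.refl (P.sqrt P.g))
  rwa [sqrt_g_mul_self] at this

theorem isPosDiag_sqrt_g : IsPosDiag (P.sqrt P.g) :=
  (P.sqrt_pos _ P.g_pos).isPosDiag P.isUnit_sqrt_g

theorem S_sqrt_g : P.W.S (P.sqrt P.g) = Ring.inverse (P.sqrt P.g) := by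
  have hu := P.isUnit_sqrt_g
  obtain ⟨y, hy, hxy⟩ := P.isPosDiag_sqrt_g.exists_inv
  have hyinv : y = Ring.inverse (P.sqrt P.g) := by
    rw [← one_mul y, ← Ring.inverse_mul_cancel _ hu, mul_assoc, hxy, mul_one]
  obtain ⟨p, hp, hq, -⟩ := P.isPosDiag_sqrt_g.exists_sqrt_polynomial hy hy
  have hyy : y * y = Ring.inverse P.g := by
    rw [hyinv, inverse_g]
  rw [sqrt_g_mul_self] at hp
  calc P.W.S (P.sqrt P.g) = P.W.S (Polynomial.aeval P.g p) := by rw [hp]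
    _ = Polynomial.aeval (Ring.inverse P.g) p := by
      rw [P.W.S_aeval]
      exact congrArg (fun z => Polynomial.aeval z p) P.g_S
    _ = _ := by rw [← hyy, hq, hyinv]

theorem Δ_sqrt_g : P.W.Δ (P.sqrt P.g) = (P.sqrt P.g ⊗ₜ[ℂ] P.sqrt P.g) * P.W.Δ 1 ∧
    P.W.Δ (P.sqrt P.g) = P.W.Δ 1 * (P.sqrt P.g ⊗ₜ[ℂ] P.sqrt P.g) := by
  have hs := P.isPosDiag_sqrt_g
  obtain ⟨p, hp, hq, -⟩ := hs.exists_sqrt_polynomial hs.tmul_self hs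
  rw [sqrt_g_mul_self] at hp
  rw [Algebra.TensorProduct.tmul_mul_tmul, sqrt_g_mul_self] at hq
  constructor
  · have := P.W.Δ_aeval (g := P.g) P.g_grouplike p
    rwa [hp, hq] at this
  · have := P.W.Δ_aeval' (g := P.g) P.g_grouplike' p
    rwa [hp, hq] at this

theorem Δ_inverse_sqrt_g : P.W.Δ (Ring.inverse (P.sqrt P.g)) =
    (Ring.inverse (P.sqrt P.g) ⊗ₜ[ℂ] Ring.inverse (P.sqrt P.g)) * P.W.Δ 1 := by
  have hu := P.isUnit_sqrt_g
  set s := P.sqrt P.g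
  calc P.W.Δ (Ring.inverse s)
      = ((Ring.inverse s * s) ⊗ₜ[ℂ] (Ring.inverse s * s)) *
          (P.W.Δ 1 * P.W.Δ (Ring.inverse s)) := by
        rw [Ring.inverse_mul_cancel _ hu, P.W.Δ_one_mul, ← Algebra.TensorProduct.one_def, one_mul]
    _ = (Ring.inverse s ⊗ₜ[ℂ] Ring.inverse s) *
          (((s ⊗ₜ[ℂ] s) * P.W.Δ 1) * P.W.Δ (Ring.inverse s)) := by
        simp only [← mul_assoc, Algebra.TensorProduct.tmul_mul_tmul]
    _ = _ := by rw [← P.Δ_sqrt_g.1, ← P.W.Δ_mul, Ring.mul_inverse_cancel _ hu]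

theorem sqrt_g_mul_h : P.sqrt P.g * P.h = P.h ∧ P.h * P.sqrt P.g = P.h := by
  have hs := P.isPosDiag_sqrt_g
  obtain ⟨p, hp, hq, -⟩ := hs.exists_sqrt_polynomial (IsPosDiag.one (B := A)) hs
  rw [sqrt_g_mul_self] at hp
  rw [one_mul] at hq
  have hl (n : ℕ) : P.g ^ n * P.h = P.h := by
    induction n with
    | zero => simp
    | succ n ih => rw [pow_succ, mul_assoc, g_mul_h, ih]
  have hr (n : ℕ) : P.h * P.g ^ n = P.h := by
    induction n with
    | zero => simp
    | succ n ih => rw [pow_succ', ← mul_assoc, h_mul_g, ih]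
  constructor
  · calc P.sqrt P.g * P.h = Polynomial.aeval P.g p * P.h := by rw [hp]
      _ = Polynomial.aeval (1 : A) p * P.h := by
        simp [Polynomial.aeval_eq_sum_range, Finset.sum_mul, hl]
      _ = P.h := by rw [hq, one_mul]
  · calc P.h * P.sqrt P.g = P.h * Polynomial.aeval P.g p := by rw [hp]
      _ = P.h * Polynomial.aeval (1 : A) p := by
        simp [Polynomial.aeval_eq_sum_range, Finset.mul_sum, hr]
      _ = P.h := by rw [hq, mul_one]

theorem commute_sqrt_g {x : A} (hx : Commute x P.g) : Commute x (P.sqrt P.g) := by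
  have hs := P.isPosDiag_sqrt_g
  obtain ⟨p, hp, -⟩ := hs.exists_sqrt_polynomial hs hs
  rw [sqrt_g_mul_self] at hp
  rw [← hp, Polynomial.aeval_eq_sum_range]
  exact Commute.sum_right _ _ _ fun i _ => (hx.pow_right i).smul_right _

/-! ### The antihomomorphism `J` -/

theorem Jlin_apply (x : A) :
    P.Jlin x = Ring.inverse (P.sqrt P.g) * P.W.S x * P.sqrt P.g := by
  simp [Jlin]

theorem Jlin_Jlin (x : A) : P.Jlin (P.Jlin x) = x := by
  have hu := P.isUnit_sqrt_g
  have hS : P.W.S (Ring.inverse (P.sqrt P.g)) = P.sqrt P.g := by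
    rw [P.S_inverse hu, S_sqrt_g, Ring.inverse_inverse hu]
  have hS2 : P.W.S (P.W.S x) = P.g * x * Ring.inverse P.g := P.S_sq x
  have hg := P.sqrt_g_mul_self
  rw [Jlin_apply, Jlin_apply, P.W.S_antimul, P.W.S_antimul, hS, S_sqrt_g, hS2, inverse_g]
  set s := P.sqrt P.g
  rw [← hg]
  simp only [mul_assoc, Ring.inverse_mul_cancel_left _ _ hu, Ring.inverse_mul_cancel _ hu, mul_one]

theorem Δ_Jlin (x : A) : P.W.Δ (P.Jlin x) =
    TensorProduct.comm ℂ A A (TensorProduct.map P.Jlin P.Jlin (P.W.Δ x)) := by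
  have key (u : A ⊗[ℂ] A) : TensorProduct.comm ℂ A A (TensorProduct.map P.Jlin P.Jlin u) =
      (Ring.inverse (P.sqrt P.g) ⊗ₜ[ℂ] Ring.inverse (P.sqrt P.g)) * TensorProduct.comm ℂ A A
        (TensorProduct.map P.W.S.toLinearMap P.W.S.toLinearMap u) *
          (P.sqrt P.g ⊗ₜ[ℂ] P.sqrt P.g) := by
    induction u with
    | zero => simp
    | add u v hu hv => simp only [add_mul, mul_add, map_add, hu, hv]
    | tmul a b => simp [Jlin_apply]
  rw [key, ← P.W.S_anticomul, Jlin_apply, P.W.Δ_mul, P.W.Δ_mul, P.Δ_inverse_sqrt_g,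
    P.Δ_sqrt_g.2, mul_assoc _ (P.W.Δ 1), P.W.Δ_one_mul, ← mul_assoc, mul_assoc _ _ (P.W.Δ 1),
    P.W.Δ_mul_one]

/-! ### The index element -/

theorem iotaEl_eq : P.iotaEl = LinearMap.mul' ℂ A
    (TensorProduct.map LinearMap.id P.W.S.toLinearMap (P.W.Δ P.h *
      ((Ring.inverse P.gL * Ring.inverse P.gL) ⊗ₜ[ℂ] 1))) := by
  have hl := P.isLeft_inverse_gL
  rw [iotaEl, WeakHopfData.εL, LinearMap.comp_apply, LinearMap.comp_apply, ← mul_assoc,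
    hl.Δ_mul_right, hl.Δ_mul_right, mul_assoc, Algebra.TensorProduct.tmul_mul_tmul, one_mul]

theorem iotaEl_comm (x : A) : x * P.iotaEl = P.iotaEl * x := by
  obtain ⟨y, rfl⟩ := P.W.S.surjective x
  have hl (u : A ⊗[ℂ] A) : LinearMap.mul' ℂ A (TensorProduct.map LinearMap.id
      P.W.S.toLinearMap ((P.W.S y ⊗ₜ[ℂ] 1) * u)) = P.W.S y *
      LinearMap.mul' ℂ A (TensorProduct.map LinearMap.id P.W.S.toLinearMap u) := by
    induction u with
    | zero => simp
    | add u v hu hv => simp only [mul_add, map_add, hu, hv]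
    | tmul a b => simp [mul_assoc]
  have hr (u : A ⊗[ℂ] A) : LinearMap.mul' ℂ A (TensorProduct.map LinearMap.id
      P.W.S.toLinearMap ((1 ⊗ₜ[ℂ] y) * u)) =
      LinearMap.mul' ℂ A (TensorProduct.map LinearMap.id P.W.S.toLinearMap u) * P.W.S y := by
    induction u with
    | zero => simp
    | add u v hu hv => simp only [add_mul, mul_add, map_add, hu, hv]
    | tmul a b => simp [P.W.S_antimul, mul_assoc]
  rw [iotaEl_eq, ← hl, ← hr, ← mul_assoc, ← mul_assoc, P.W.S_tmul_mul_Δ P.haar_left]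

theorem S_iotaEl : P.W.S P.iotaEl = P.iotaEl := by
  set k := Ring.inverse P.gL * Ring.inverse P.gL with hk
  have hu := P.isUnit_g
  have hc : Commute P.gL P.gR := P.gLR_comm
  have hc' : Commute P.gL (Ring.inverse P.gR) := commute_inverse_right hc
  have hSk : P.W.S k = P.g * k * P.g := by
    have hg : P.g = Ring.inverse P.gR * P.gL := hc'.eq
    calc P.W.S k = Ring.inverse P.gR * Ring.inverse P.gR := by
          rw [hk, P.W.S_antimul, P.S_inverse P.gL_unit, P.gR_S]
      _ = P.g * k * P.g := by
          nth_rw 1 [hg]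
          rw [hk, g]
          simp only [mul_assoc]
          rw [Ring.mul_inverse_cancel_left _ _ P.gL_unit, Ring.inverse_mul_cancel_left _ _ P.gL_unit]
  let Q : A ⊗[ℂ] A →ₗ[ℂ] A := LinearMap.mul' ℂ A ∘ₗ TensorProduct.map
    (LinearMap.mulRight ℂ (Ring.inverse P.g * P.W.S k) ∘ₗ LinearMap.mulLeft ℂ P.g)
    P.W.S.toLinearMap
  let R : A ⊗[ℂ] A →ₗ[ℂ] A := LinearMap.mul' ℂ A ∘ₗ
    TensorProduct.map LinearMap.id P.W.S.toLinearMap ∘ₗ LinearMap.mulRight ℂ (k ⊗ₜ[ℂ] 1)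
  have hι : P.iotaEl = R (P.W.Δ P.h) := by rw [iotaEl_eq]; rfl
  have hSQ (u : A ⊗[ℂ] A) : P.W.S (R u) = Q (TensorProduct.comm ℂ A A u) := by
    induction u with
    | zero => simp
    | add u v hu hv => simp only [map_add, hu, hv]
    | tmul a b =>
      have hS2 : P.W.S (P.W.S b) = P.g * b * Ring.inverse P.g := P.S_sq b
      simp [R, Q, P.W.S_antimul, hS2, mul_assoc]
  have hQR (u : A ⊗[ℂ] A) : Q (TensorProduct.map LinearMap.id
      (LinearMap.mulLeft ℂ P.g ∘ₗ LinearMap.mulRight ℂ P.g) u) =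
      P.g * R u * Ring.inverse P.g := by
    induction u with
    | zero => simp
    | add u v hu hv => simp only [map_add, hu, hv, mul_add, add_mul]
    | tmul a b =>
      have hSg : P.W.S P.g = Ring.inverse P.g := P.g_S
      simp only [R, Q, LinearMap.comp_apply, TensorProduct.map_tmul, LinearMap.id_apply,
        LinearMap.mulLeft_apply, LinearMap.mulRight_apply, LinearMap.mul'_apply,
        Algebra.TensorProduct.tmul_mul_tmul, mul_one, LinearEquiv.coe_coe, P.W.S_antimul, hSg, hSk]
      simp only [mul_assoc, Ring.inverse_mul_cancel_left _ _ hu,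
        Ring.mul_inverse_cancel_left _ _ hu]
  have hflip : TensorProduct.map LinearMap.id (LinearMap.mulLeft ℂ P.g ∘ₗ LinearMap.mulRight ℂ P.g)
      (P.W.Δ P.h) = TensorProduct.comm ℂ A A (P.W.Δ P.h) := P.haar_flip
  calc P.W.S P.iotaEl = P.g * P.iotaEl * Ring.inverse P.g := by
        rw [hι, hSQ, ← hflip, hQR]
    _ = P.iotaEl := by rw [iotaEl_comm, mul_assoc, Ring.mul_inverse_cancel _ hu, mul_one]

theorem isLeft_iotaEl : P.W.IsLeft P.iotaEl := P.W.isLeft_εL _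

theorem isRight_iotaEl : P.W.IsRight P.iotaEl := P.S_iotaEl ▸ P.isLeft_iotaEl.S

/-! ### The pulling-through element -/

theorem inverse_mul_h_mul_inverse : Ring.inverse P.gR * P.h * Ring.inverse P.gR =
    Ring.inverse P.gL * P.h * Ring.inverse P.gL := by
  rw [inverse_mul_h, mul_assoc, h_mul_inverse, mul_assoc]

theorem Ω_eq : P.Ω = Ring.inverse P.iotaEl * (Ring.inverse P.gL * P.h * Ring.inverse P.gL) := by
  simp only [Ω, mul_assoc]

theorem Jlin_Ω (hι : IsUnit P.iotaEl) : P.Jlin P.Ω = P.Ω := by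
  have hu := P.isUnit_sqrt_g
  have hcι (x : A) : x * Ring.inverse P.iotaEl = Ring.inverse P.iotaEl * x :=
    (commute_inverse_right (P.iotaEl_comm x)).eq
  have hcR : Commute (Ring.inverse P.gR) (P.sqrt P.g) :=
    (commute_inverse_right (P.commute_sqrt_g P.commute_gR_g).symm).symm
  have hcR' : Commute (Ring.inverse P.gR) (Ring.inverse (P.sqrt P.g)) := commute_inverse_right hcR
  have hsh : Ring.inverse (P.sqrt P.g) * P.h = P.h := by
    nth_rw 1 [← P.sqrt_g_mul_h.1]
    rw [Ring.inverse_mul_cancel_left _ _ hu]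
  calc P.Jlin P.Ω = Ring.inverse (P.sqrt P.g) * (Ring.inverse P.gR * P.h * Ring.inverse P.gR *
        Ring.inverse P.iotaEl) * P.sqrt P.g := by
        rw [Jlin_apply, Ω_eq, P.W.S_antimul, P.W.S_antimul, P.W.S_antimul, P.haar_S,
          P.S_inverse hι, S_iotaEl, P.S_inverse P.gL_unit, ← P.gR_S]
        simp only [mul_assoc]
    _ = Ring.inverse P.iotaEl * (Ring.inverse (P.sqrt P.g) * Ring.inverse P.gR * P.h *
        (Ring.inverse P.gR * P.sqrt P.g)) := by
        rw [hcι, ← mul_assoc, hcι]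
        simp only [mul_assoc]
    _ = P.Ω := by
        rw [← hcR'.eq, hcR.eq, mul_assoc _ _ P.h, hsh, mul_assoc, ← mul_assoc P.h,
          P.sqrt_g_mul_h.2, ← mul_assoc (Ring.inverse P.gR), inverse_mul_h_mul_inverse, Ω_eq]

theorem comm_Δ_Ω (hι : IsUnit P.iotaEl) :
    TensorProduct.comm ℂ A A (P.W.Δ P.Ω) = P.W.Δ P.Ω := by
  have hl := P.isLeft_inverse_gL
  have hr := P.isRight_inverse_gR
  have hu := P.isUnit_g
  set x := Ring.inverse P.gL * P.h * Ring.inverse P.gL with hx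
  have hflip : TensorProduct.comm ℂ A A (P.W.Δ P.h) =
      (1 ⊗ₜ[ℂ] P.g) * P.W.Δ P.h * (1 ⊗ₜ[ℂ] P.g) := by
    refine (show _ = TensorProduct.map LinearMap.id
      (LinearMap.mulLeft ℂ P.g ∘ₗ LinearMap.mulRight ℂ P.g) (P.W.Δ P.h) from
        P.haar_flip.symm).trans ?_
    induction P.W.Δ P.h with
    | zero => simp
    | add u v hu hv => simp only [map_add, mul_add, add_mul, hu, hv]
    | tmul a b => simp [mul_assoc]
  have hgL : Ring.inverse P.gL * P.g = Ring.inverse P.gR := by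
    rw [g, Ring.inverse_mul_cancel_left _ _ P.gL_unit]
  have hgR : P.g * Ring.inverse P.gL = Ring.inverse P.gR := by
    rw [← (commute_inverse_right P.commute_gL_g.symm).eq.symm, hgL]
  have hcomm : TensorProduct.comm ℂ A A (P.W.Δ x) = P.W.Δ x := by
    calc TensorProduct.comm ℂ A A (P.W.Δ x) = (1 ⊗ₜ[ℂ] Ring.inverse P.gL) *
          TensorProduct.comm ℂ A A (P.W.Δ P.h) * (1 ⊗ₜ[ℂ] Ring.inverse P.gL) := by
          rw [hx, hl.Δ_mul_right, hl.Δ_mul_left, comm_mul, comm_mul, TensorProduct.comm_tmul]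
      _ = ((1 ⊗ₜ[ℂ] Ring.inverse P.gL) * (1 ⊗ₜ[ℂ] P.g)) * P.W.Δ P.h *
          ((1 ⊗ₜ[ℂ] P.g) * (1 ⊗ₜ[ℂ] Ring.inverse P.gL)) := by
          rw [hflip]
          simp only [mul_assoc]
      _ = P.W.Δ (Ring.inverse P.gR * P.h * Ring.inverse P.gR) := by
          rw [Algebra.TensorProduct.tmul_mul_tmul, Algebra.TensorProduct.tmul_mul_tmul, one_mul,
            hgL, hgR, hr.Δ_mul_right, hr.Δ_mul_left]
      _ = P.W.Δ x := by rw [inverse_mul_h_mul_inverse]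
  rw [Ω_eq, ← hx]
  conv_rhs => rw [(P.isRight_iotaEl.inverse hι).Δ_mul_left]
  rw [(P.isLeft_iotaEl.inverse hι).Δ_mul_left, comm_mul, hcomm, TensorProduct.comm_tmul]

end HaarPkg

/-- **Exchanging `J` between complementary legs of the coproduct of `Ω`.**
For `n = m + 2 ≥ 2` and any subset `I` of the `n` legs, applying `J` to the legs in `I` of
`Δ⁽ⁿ⁻¹⁾ Ω = Ω₍₁₎ ⊗ ⋯ ⊗ Ω₍ₙ₎` yields the same element of `A^{⊗n}` as applying `J` to the
complementary legs of the reordered coproduct `Ω₍₁₎ ⊗ Ω₍ₙ₎ ⊗ Ω₍ₙ₋₁₎ ⊗ ⋯ ⊗ Ω₍₂₎`.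
The identity in `A^{⊗n}` is expressed, equivalently, through full contractions against an
arbitrary family `ψ` of linear functionals (which separate the points of tensor powers);
the reordering becomes the index permutation `0 ↦ 0`, `k ↦ n - k` (`k ≠ 0`). -/
theorem HaarPkg.omega_coproduct_J_reversal {A : Type*} [NormedRing A] [StarRing A]
    [CStarRing A] [NormedAlgebra ℂ A] [StarModule ℂ A] [FiniteDimensional ℂ A]
    (P : HaarPkg A) (m : ℕ) (I : Set (Fin (m + 2))) [DecidablePred (· ∈ I)]
    (ψ : Fin (m + 2) → (A →ₗ[ℂ] ℂ)) :
    WeakHopfData.sweedlerEval P.W (m + 1)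
        (fun k => if k ∈ I then ψ k ∘ₗ P.Jlin else ψ k) P.Ω
      = WeakHopfData.sweedlerEval P.W (m + 1)
          (fun k =>
            if hk : k.val = 0 then
              (if k ∈ I then ψ k else ψ k ∘ₗ P.Jlin)
            else
              (if (⟨m + 2 - k.val, by omega⟩ : Fin (m + 2)) ∈ I then
                ψ (⟨m + 2 - k.val, by omega⟩ : Fin (m + 2))
              else ψ (⟨m + 2 - k.val, by omega⟩ : Fin (m + 2)) ∘ₗ P.Jlin)) P.Ω := by
  by_cases hι : IsUnit P.iotaEl
  swap
  · simp [HaarPkg.Ω, Ring.inverse_non_unit _ hι]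
  set θ : Fin (m + 2) → (A →ₗ[ℂ] ℂ) := fun k => if k ∈ I then ψ k else ψ k ∘ₗ P.Jlin with hθ
  have hθJ (k : Fin (m + 2)) : (if k ∈ I then ψ k ∘ₗ P.Jlin else ψ k) = θ k ∘ₗ P.Jlin := by
    by_cases hk : k ∈ I
    · simp [hθ, hk]
    · ext x
      simp [hθ, hk, P.Jlin_Jlin]
  have hr (k : Fin (m + 2)) : (if hk : k.val = 0 then θ k else
      θ (⟨m + 2 - k.val, by omega⟩ : Fin (m + 2))) = θ (-k) := by
    split_ifs with hk
    · congr 1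
      have : k = 0 := Fin.ext hk
      simp [this]
    · congr 1
      ext
      rw [Fin.val_neg']
      exact (Nat.mod_eq_of_lt (by omega)).symm
  simp only [hθJ]
  change _ = WeakHopfData.sweedlerEval P.W (m + 1) (fun k => if hk : k.val = 0 then θ k else
      θ (⟨m + 2 - k.val, by omega⟩ : Fin (m + 2))) P.Ω
  simp only [hr]
  rw [P.W.sweedlerEval_comp_anti P.Δ_Jlin, LinearMap.comp_apply, P.Jlin_Ω hι,
    ← P.W.sweedlerEval_cyclic (P.comm_Δ_Ω hι) m fun k => θ (-k)]
  congr 2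
  funext k
  induction k using Fin.lastCases with
  | last =>
    simp
  | cast k =>
    simp only [Fin.snoc_castSucc, Fin.tail]
    congr 1
    ext
    rw [Fin.val_neg', Fin.val_rev, Fin.val_succ, Fin.val_castSucc,
      Nat.mod_eq_of_lt (by omega)]

end
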